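/- arXiv:1409.6936 — 4 statements merged into one kernel-verified Lean document; each statement's English description precedes it below -/
import Mathlib

section
/- Let (H, α) be a monoidal Hom-Hopf T-coalgebra over G with bijective antipode, (M, μ) a p-Yetter–Drinfeld module and (N, ν) a q-Yetter–Drinfeld module over (H, α). Equip M ⊗ N with the H_{pq}-action h·(m ⊗ n) = h_{(1,p)}·m ⊗ h_{(2,q)}·n and coactions ρ^{M⊗N}_r(m ⊗ n) = m_{(0)} ⊗ n_{(0)} ⊗ n_{(1,r)}π_{q^{-1}}(m_{(1,qrq^{-1})}). Then the Yetter–Drinfeld compatibility holds for M ⊗ N: for all r ∈ G, h ∈ H_{pqr}, m ∈ M, n ∈ N, h_{(1,pq)}·(m ⊗ n)_{(0)} ⊗ h_{(2,r)}(m ⊗ n)_{(1,r)} = (μ ⊗ ν)((h_{(2,pq)}·((μ⊗ν)^{-1}(m ⊗ n)))_{(0)}) ⊗ (h_{(2,pq)}·((μ⊗ν)^{-1}(m ⊗ n)))_{(1,r)} π_{(pq)^{-1}}(h_{(1,pqr(pq)^{-1})}). -/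
open TensorProduct

noncomputable section

section Cast

variable (k : Type*) [Field k] {G : Type*} [Group G] {H : G → Type*}
  [∀ p, AddCommGroup (H p)] [∀ p, Module k (H p)]

/-- Transport of components along an equality of group elements. -/
def cst {a b : G} (h : a = b) : H a →ₗ[k] H b := by subst h; exact LinearMap.id

/-- Transport of components along an equality of group elements, as a linear equivalence. -/
def cstE {a b : G} (h : a = b) : H a ≃ₗ[k] H b := by subst h; exact LinearEquiv.refl k (H a)

end Cast

/-- A (classical) Hopf group-coalgebra over a group `G`. -/
structure HopfGC (k : Type*) [Field k] (G : Type*) [Group G] (H : G → Type*)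
    [∀ p, AddCommGroup (H p)] [∀ p, Module k (H p)] where
  mul : ∀ p : G, H p →ₗ[k] H p →ₗ[k] H p
  one : ∀ p : G, H p
  comul : ∀ p q : G, H (p * q) →ₗ[k] H p ⊗[k] H q
  counit : H (1 : G) →ₗ[k] k
  antipode : ∀ p : G, H p →ₗ[k] H p⁻¹
  mul_assoc' : ∀ (p : G) (a b c : H p), mul p (mul p a b) c = mul p a (mul p b c)
  one_mul' : ∀ (p : G) (a : H p), mul p (one p) a = a
  mul_one' : ∀ (p : G) (a : H p), mul p a (one p) = a
  coassoc : ∀ p q r : G,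
    (TensorProduct.assoc k (H p) (H q) (H r)).toLinearMap.comp
      ((TensorProduct.map (comul p q) LinearMap.id).comp (comul (p * q) r))
    = (TensorProduct.map LinearMap.id (comul q r)).comp
        ((comul p (q * r)).comp (cst k (mul_assoc p q r)))
  counit_comul' : ∀ (p : G) (c : H p),
    (TensorProduct.lid k (H p))
      ((TensorProduct.map counit LinearMap.id) (comul 1 p (cst k (one_mul p).symm c))) = c
  comul_counit' : ∀ (p : G) (c : H p),
    (TensorProduct.rid k (H p))
      ((TensorProduct.map LinearMap.id counit) (comul p 1 (cst k (mul_one p).symm c))) = c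
  comul_mul : ∀ (p q : G) (a b : H (p * q)),
    comul p q (mul (p * q) a b)
      = TensorProduct.map₂ (mul p) (mul q) (comul p q a) (comul p q b)
  comul_one : ∀ p q : G, comul p q (one (p * q)) = (one p) ⊗ₜ[k] (one q)
  counit_mul : ∀ a b : H (1 : G), counit (mul 1 a b) = counit a * counit b
  counit_one : counit (one 1) = 1
  antipode_left : ∀ (p : G) (h : H (1 : G)),
    TensorProduct.lift (mul p)
      ((TensorProduct.map ((cst k (inv_inv p)).comp (antipode p⁻¹)) LinearMap.id)
        (comul p⁻¹ p (cst k (show (1 : G) = p⁻¹ * p by group) h)))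
    = counit h • one p
  antipode_right : ∀ (p : G) (h : H (1 : G)),
    TensorProduct.lift (mul p)
      ((TensorProduct.map LinearMap.id ((cst k (inv_inv p)).comp (antipode p⁻¹)))
        (comul p p⁻¹ (cst k (show (1 : G) = p * p⁻¹ by group) h)))
    = counit h • one p

/-- An automorphism of a Hopf group-coalgebra. -/
structure HopfGCAut {k : Type*} [Field k] {G : Type*} [Group G] {H : G → Type*}
    [∀ p, AddCommGroup (H p)] [∀ p, Module k (H p)] (D : HopfGC k G H) where
  α : ∀ p : G, H p ≃ₗ[k] H p
  map_mul : ∀ (p : G) (a b : H p), α p (D.mul p a b) = D.mul p (α p a) (α p b)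
  map_one : ∀ p : G, α p (D.one p) = D.one p
  map_comul : ∀ (p q : G) (c : H (p * q)),
    TensorProduct.map (α p).toLinearMap (α q).toLinearMap (D.comul p q c)
      = D.comul p q (α (p * q) c)
  map_counit : ∀ c : H (1 : G), D.counit (α 1 c) = D.counit c
  map_antipode : ∀ (p : G) (h : H p), D.antipode p (α p h) = α p⁻¹ (D.antipode p h)

/-- The axioms of a group-cograded monoidal Hom-Hopf algebra, for given structure data. -/
structure IsGCHH (k : Type*) [Field k] {G : Type*} [Group G] {H : G → Type*}
    [∀ p, AddCommGroup (H p)] [∀ p, Module k (H p)]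
    (mul : ∀ p : G, H p →ₗ[k] H p →ₗ[k] H p) (one : ∀ p : G, H p)
    (comul : ∀ p q : G, H (p * q) →ₗ[k] H p ⊗[k] H q) (counit : H (1 : G) →ₗ[k] k)
    (antipode : ∀ p : G, H p →ₗ[k] H p⁻¹) (α : ∀ p : G, H p ≃ₗ[k] H p) : Prop where
  hom_assoc : ∀ (p : G) (a b c : H p), mul p (α p a) (mul p b c) = mul p (mul p a b) (α p c)
  one_mul' : ∀ (p : G) (a : H p), mul p (one p) a = α p a
  mul_one' : ∀ (p : G) (a : H p), mul p a (one p) = α p a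
  α_mul : ∀ (p : G) (a b : H p), α p (mul p a b) = mul p (α p a) (α p b)
  α_one : ∀ p : G, α p (one p) = one p
  hcoassoc : ∀ p q r : G,
    (TensorProduct.map (α p).symm.toLinearMap (comul q r)).comp
      ((comul p (q * r)).comp (cst k (mul_assoc p q r)))
    = (TensorProduct.assoc k (H p) (H q) (H r)).toLinearMap.comp
        ((TensorProduct.map (comul p q) (α r).symm.toLinearMap).comp (comul (p * q) r))
  counit_comul' : ∀ (p : G) (c : H p),
    (TensorProduct.lid k (H p))
      ((TensorProduct.map counit LinearMap.id) (comul 1 p (cst k (one_mul p).symm c)))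
    = (α p).symm c
  comul_counit' : ∀ (p : G) (c : H p),
    (TensorProduct.rid k (H p))
      ((TensorProduct.map LinearMap.id counit) (comul p 1 (cst k (mul_one p).symm c)))
    = (α p).symm c
  comul_αinv : ∀ (p q : G) (c : H (p * q)),
    comul p q ((α (p * q)).symm c)
      = TensorProduct.map (α p).symm.toLinearMap (α q).symm.toLinearMap (comul p q c)
  counit_αinv : ∀ c : H (1 : G), counit ((α 1).symm c) = counit c
  comul_mul : ∀ (p q : G) (a b : H (p * q)),
    comul p q (mul (p * q) a b)
      = TensorProduct.map₂ (mul p) (mul q) (comul p q a) (comul p q b)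
  comul_one : ∀ p q : G, comul p q (one (p * q)) = (one p) ⊗ₜ[k] (one q)
  counit_mul : ∀ a b : H (1 : G), counit (mul 1 a b) = counit a * counit b
  counit_one : counit (one 1) = 1
  antipode_α : ∀ (p : G) (h : H p), antipode p (α p h) = (α p⁻¹) (antipode p h)
  antipode_left : ∀ (p : G) (h : H (1 : G)),
    TensorProduct.lift (mul p)
      ((TensorProduct.map ((cst k (inv_inv p)).comp (antipode p⁻¹)) LinearMap.id)
        (comul p⁻¹ p (cst k (show (1 : G) = p⁻¹ * p by group) h)))
    = counit h • one p
  antipode_right : ∀ (p : G) (h : H (1 : G)),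
    TensorProduct.lift (mul p)
      ((TensorProduct.map LinearMap.id ((cst k (inv_inv p)).comp (antipode p⁻¹)))
        (comul p p⁻¹ (cst k (show (1 : G) = p * p⁻¹ by group) h)))
    = counit h • one p

/-- The axioms of a crossing on a group-cograded (monoidal Hom-)Hopf algebra. -/
structure IsCrossing (k : Type*) [Field k] {G : Type*} [Group G] {H : G → Type*}
    [∀ p, AddCommGroup (H p)] [∀ p, Module k (H p)]
    (mul : ∀ p : G, H p →ₗ[k] H p →ₗ[k] H p) (one : ∀ p : G, H p)
    (comul : ∀ p q : G, H (p * q) →ₗ[k] H p ⊗[k] H q) (counit : H (1 : G) →ₗ[k] k)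
    (α : ∀ p : G, H p ≃ₗ[k] H p)
    (π : ∀ q p : G, H p ≃ₗ[k] H (q * p * q⁻¹)) : Prop where
  π_mul : ∀ (q p : G) (a b : H p),
    π q p (mul p a b) = mul (q * p * q⁻¹) (π q p a) (π q p b)
  π_one : ∀ q p : G, π q p (one p) = one (q * p * q⁻¹)
  π_α : ∀ (q p : G) (a : H p), π q p (α p a) = α (q * p * q⁻¹) (π q p a)
  π_comul : ∀ (q a b : G) (c : H (a * b)),
    TensorProduct.map (π q a).toLinearMap (π q b).toLinearMap (comul a b c)
      = comul (q * a * q⁻¹) (q * b * q⁻¹)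
          (cst k (show q * (a * b) * q⁻¹ = (q * a * q⁻¹) * (q * b * q⁻¹) by group) (π q (a * b) c))
  π_counit : ∀ (q : G) (c : H (1 : G)),
    counit (cst k (show q * (1 : G) * q⁻¹ = 1 by group) (π q 1 c)) = counit c
  π_mult : ∀ (a b p : G) (c : H p),
    cst k (show (a * b) * p * (a * b)⁻¹ = a * (b * p * b⁻¹) * a⁻¹ by group) (π (a * b) p c)
      = π a (b * p * b⁻¹) (π b p c)

/-- A (classical) Hopf `T`-coalgebra: a Hopf group-coalgebra with a crossing. -/
structure HopfTC (k : Type*) [Field k] (G : Type*) [Group G] (H : G → Type*)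
    [∀ p, AddCommGroup (H p)] [∀ p, Module k (H p)] extends HopfGC k G H where
  π : ∀ q p : G, H p ≃ₗ[k] H (q * p * q⁻¹)
  π_mul : ∀ (q p : G) (a b : H p),
    π q p (mul p a b) = mul (q * p * q⁻¹) (π q p a) (π q p b)
  π_one : ∀ q p : G, π q p (one p) = one (q * p * q⁻¹)
  π_comul : ∀ (q a b : G) (c : H (a * b)),
    TensorProduct.map (π q a).toLinearMap (π q b).toLinearMap (comul a b c)
      = comul (q * a * q⁻¹) (q * b * q⁻¹)
          (cst k (show q * (a * b) * q⁻¹ = (q * a * q⁻¹) * (q * b * q⁻¹) by group) (π q (a * b) c))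
  π_counit : ∀ (q : G) (c : H (1 : G)),
    counit (cst k (show q * (1 : G) * q⁻¹ = 1 by group) (π q 1 c)) = counit c
  π_antipode : ∀ (q p : G) (h : H p),
    antipode (q * p * q⁻¹) (π q p h)
      = cst k (show q * p⁻¹ * q⁻¹ = (q * p * q⁻¹)⁻¹ by group) (π q p⁻¹ (antipode p h))
  π_mult : ∀ (a b p : G) (c : H p),
    cst k (show (a * b) * p * (a * b)⁻¹ = a * (b * p * b⁻¹) * a⁻¹ by group) (π (a * b) p c)
      = π a (b * p * b⁻¹) (π b p c)

/-- A group-cograded monoidal Hom-Hopf algebra (bundled data). -/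
structure GCHH (k : Type*) [Field k] (G : Type*) [Group G] (H : G → Type*)
    [∀ p, AddCommGroup (H p)] [∀ p, Module k (H p)] where
  mul : ∀ p : G, H p →ₗ[k] H p →ₗ[k] H p
  one : ∀ p : G, H p
  comul : ∀ p q : G, H (p * q) →ₗ[k] H p ⊗[k] H q
  counit : H (1 : G) →ₗ[k] k
  antipode : ∀ p : G, H p →ₗ[k] H p⁻¹
  α : ∀ p : G, H p ≃ₗ[k] H p
  ax : IsGCHH k mul one comul counit antipode α

/-- A monoidal Hom-Hopf `T`-coalgebra with bijective antipode (bundled data). -/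
structure HomTC (k : Type*) [Field k] (G : Type*) [Group G] (H : G → Type*)
    [∀ p, AddCommGroup (H p)] [∀ p, Module k (H p)] where
  mul : ∀ p : G, H p →ₗ[k] H p →ₗ[k] H p
  one : ∀ p : G, H p
  comul : ∀ p q : G, H (p * q) →ₗ[k] H p ⊗[k] H q
  counit : H (1 : G) →ₗ[k] k
  antipode : ∀ p : G, H p ≃ₗ[k] H p⁻¹
  α : ∀ p : G, H p ≃ₗ[k] H p
  π : ∀ q p : G, H p ≃ₗ[k] H (q * p * q⁻¹)
  ax : IsGCHH k mul one comul counit (fun p => (antipode p).toLinearMap) α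
  cax : IsCrossing k mul one comul counit α π

section YD

variable {k : Type*} [Field k] {G : Type*} [Group G] {H : G → Type*}
  [∀ p, AddCommGroup (H p)] [∀ p, Module k (H p)]

variable (k)

/-- The Yetter-Drinfeld compatibility condition (3) of Definition 4.1. -/
def YDcompat (T : HomTC k G H) (p : G) {M : Type*} [AddCommGroup M] [Module k M]
    (μ : M ≃ₗ[k] M) (act : H p →ₗ[k] M →ₗ[k] M)
    (ρ : ∀ r : G, M →ₗ[k] M ⊗[k] H r) : Prop :=
  ∀ r : G,
    (TensorProduct.map (TensorProduct.lift act) (TensorProduct.lift (T.mul r))).comp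
      ((TensorProduct.tensorTensorTensorComm k (H p) (H r) M (H r)).toLinearMap.comp
        (TensorProduct.map (T.comul p r) (ρ r)))
    =
    (TensorProduct.map μ.toLinearMap (TensorProduct.lift (T.mul r))).comp
      ((TensorProduct.assoc k M (H r) (H r)).toLinearMap.comp
        (((TensorProduct.comm k (H r) (M ⊗[k] H r)).toLinearMap).comp
          ((TensorProduct.map
              ((cst k (show p⁻¹ * (p * r * p⁻¹) * p⁻¹⁻¹ = r by group)).comp
                (T.π p⁻¹ (p * r * p⁻¹)).toLinearMap)
              ((ρ r).comp (TensorProduct.lift act))).comp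
            ((TensorProduct.assoc k (H (p * r * p⁻¹)) (H p) M).toLinearMap.comp
              (TensorProduct.map
                ((T.comul (p * r * p⁻¹) p).comp
                  (cst k (show p * r = (p * r * p⁻¹) * p by group)))
                μ.symm.toLinearMap)))))

/-- The axioms of a (left-right) `p`-Yetter-Drinfeld module over a monoidal Hom-Hopf
`T`-coalgebra. -/
structure IsYD (T : HomTC k G H) (p : G) {M : Type*} [AddCommGroup M] [Module k M]
    (μ : M ≃ₗ[k] M) (act : H p →ₗ[k] M →ₗ[k] M)
    (ρ : ∀ r : G, M →ₗ[k] M ⊗[k] H r) : Prop where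
  act_act : ∀ (a b : H p) (m : M), act (T.α p a) (act b m) = act (T.mul p a b) (μ m)
  act_one : ∀ m : M, act (T.one p) m = μ m
  μ_act : ∀ (a : H p) (m : M), μ (act a m) = act (T.α p a) (μ m)
  ρ_coassoc : ∀ a b : G,
    (TensorProduct.map μ.symm.toLinearMap (T.comul a b)).comp (ρ (a * b))
    = (TensorProduct.assoc k M (H a) (H b)).toLinearMap.comp
        ((TensorProduct.map (ρ a) (T.α b).symm.toLinearMap).comp (ρ b))
  ρ_counit : ∀ m : M,
    (TensorProduct.rid k M) ((TensorProduct.map LinearMap.id T.counit) (ρ 1 m)) = μ.symm m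
  ρ_μ : ∀ r : G,
    (ρ r).comp μ.toLinearMap
      = (TensorProduct.map μ.toLinearMap (T.α r).toLinearMap).comp (ρ r)
  compat : YDcompat k T p μ act ρ

/-- The action of `H (a*b)` on a tensor product of an `H a`-module and an `H b`-module. -/
def tAct (T : HomTC k G H) (a b : G) {M N : Type*} [AddCommGroup M] [Module k M]
    [AddCommGroup N] [Module k N]
    (actM : H a →ₗ[k] M →ₗ[k] M) (actN : H b →ₗ[k] N →ₗ[k] N) :
    H (a * b) →ₗ[k] (M ⊗[k] N) →ₗ[k] (M ⊗[k] N) :=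
  (TensorProduct.map₂ actM actN).comp (T.comul a b)

/-- The coaction on the tensor product `M ⊗ N`, where `N` has degree `b`:
`ρ r (m ⊗ n) = m₍₀₎ ⊗ n₍₀₎ ⊗ n₍₁,r₎ ⬝ π_{b⁻¹}(m₍₁,brb⁻¹₎)`. -/
def tCoact (T : HomTC k G H) (b : G) {M N : Type*} [AddCommGroup M] [Module k M]
    [AddCommGroup N] [Module k N]
    (ρM : ∀ r : G, M →ₗ[k] M ⊗[k] H r) (ρN : ∀ r : G, N →ₗ[k] N ⊗[k] H r) (r : G) :
    (M ⊗[k] N) →ₗ[k] (M ⊗[k] N) ⊗[k] H r :=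
  (TensorProduct.map LinearMap.id
      (TensorProduct.lift (((T.mul r).flip).comp
        ((cst k (show b⁻¹ * (b * r * b⁻¹) * b⁻¹⁻¹ = r by group)).comp
          (T.π b⁻¹ (b * r * b⁻¹)).toLinearMap)))).comp
    ((TensorProduct.tensorTensorTensorComm k M (H (b * r * b⁻¹)) N (H r)).toLinearMap.comp
      (TensorProduct.map (ρM (b * r * b⁻¹)) (ρN r)))

/-- The conjugate action on `ᵠM`: `h ⇀ m = π_{s⁻¹}(h) ⬝ m`. -/
def cAct (T : HomTC k G H) (s p : G) {M : Type*} [AddCommGroup M] [Module k M]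
    (act : H p →ₗ[k] M →ₗ[k] M) : H (s * p * s⁻¹) →ₗ[k] M →ₗ[k] M :=
  act.comp ((cst k (show s⁻¹ * (s * p * s⁻¹) * s⁻¹⁻¹ = p by group)).comp
    (T.π s⁻¹ (s * p * s⁻¹)).toLinearMap)

/-- The conjugate coaction on `ˢM`: `ρ r m = m₍₀₎ ⊗ π_s (m₍₁,s⁻¹rs₎)`. -/
def cCoact (T : HomTC k G H) (s : G) {M : Type*} [AddCommGroup M] [Module k M]
    (ρ : ∀ r : G, M →ₗ[k] M ⊗[k] H r) (r : G) : M →ₗ[k] M ⊗[k] H r :=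
  (TensorProduct.map LinearMap.id
      ((cst k (show s * (s⁻¹ * r * s) * s⁻¹ = r by group)).comp
        (T.π s (s⁻¹ * r * s)).toLinearMap)).comp
    (ρ (s⁻¹ * r * s))

/-- The Hom-associator `(A ⊗ B) ⊗ C ≃ A ⊗ (B ⊗ C)`, `(a ⊗ b) ⊗ c ↦ φA a ⊗ (b ⊗ φC⁻¹ c)`. -/
def homAssoc {A B C : Type*} [AddCommGroup A] [Module k A] [AddCommGroup B] [Module k B]
    [AddCommGroup C] [Module k C] (φA : A ≃ₗ[k] A) (φC : C ≃ₗ[k] C) :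
    (A ⊗[k] B) ⊗[k] C ≃ₗ[k] A ⊗[k] (B ⊗[k] C) :=
  (TensorProduct.assoc k A B C).trans
    (TensorProduct.congr φA (TensorProduct.congr (LinearEquiv.refl k B) φC.symm))

/-- The braiding `c_{M,W} : M ⊗ W → ᴹW ⊗ M`,
`m ⊗ w ↦ (S_{w⁻¹}(m₍₁,w⁻¹₎) ⬝ φW⁻¹ w) ⊗ μ m₍₀₎`, where `W` has degree `w`. -/
def braid (T : HomTC k G H) (w : G) {M W : Type*} [AddCommGroup M] [Module k M]
    [AddCommGroup W] [Module k W] (μ : M ≃ₗ[k] M) (ρM : ∀ r : G, M →ₗ[k] M ⊗[k] H r)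
    (actW : H w →ₗ[k] W →ₗ[k] W) (φW : W ≃ₗ[k] W) : (M ⊗[k] W) →ₗ[k] (W ⊗[k] M) :=
  (TensorProduct.comm k M W).toLinearMap.comp
    ((TensorProduct.map μ.toLinearMap
        (TensorProduct.lift (actW.comp
          ((cst k (inv_inv w)).comp (T.antipode w⁻¹).toLinearMap)))).comp
      ((TensorProduct.assoc k M (H w⁻¹) W).toLinearMap.comp
        (TensorProduct.map (ρM w⁻¹) φW.symm.toLinearMap)))

end YD

/-- The axioms of a monoidal Hom-Hopf algebra on a single space. -/
structure IsMonHomHopf (k : Type*) [Field k] (A : Type*) [AddCommGroup A] [Module k A]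
    (mul : A →ₗ[k] A →ₗ[k] A) (one : A) (comul : A →ₗ[k] A ⊗[k] A) (counit : A →ₗ[k] k)
    (S : A →ₗ[k] A) (α : A ≃ₗ[k] A) : Prop where
  hom_assoc : ∀ a b c : A, mul (α a) (mul b c) = mul (mul a b) (α c)
  one_mul' : ∀ a : A, mul one a = α a
  mul_one' : ∀ a : A, mul a one = α a
  α_mul : ∀ a b : A, α (mul a b) = mul (α a) (α b)
  α_one : α one = one
  hcoassoc :
    (TensorProduct.map α.symm.toLinearMap comul).comp comul
    = (TensorProduct.assoc k A A A).toLinearMap.comp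
        ((TensorProduct.map comul α.symm.toLinearMap).comp comul)
  counit_comul' : ∀ a : A,
    (TensorProduct.lid k A) ((TensorProduct.map counit LinearMap.id) (comul a)) = α.symm a
  comul_counit' : ∀ a : A,
    (TensorProduct.rid k A) ((TensorProduct.map LinearMap.id counit) (comul a)) = α.symm a
  comul_αinv : ∀ a : A,
    comul (α.symm a) = TensorProduct.map α.symm.toLinearMap α.symm.toLinearMap (comul a)
  counit_αinv : ∀ a : A, counit (α.symm a) = counit a
  comul_mul : ∀ a b : A, comul (mul a b) = TensorProduct.map₂ mul mul (comul a) (comul b)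
  comul_one : comul one = one ⊗ₜ[k] one
  counit_mul : ∀ a b : A, counit (mul a b) = counit a * counit b
  counit_one : counit one = 1
  antipode_α : ∀ a : A, S (α a) = α (S a)
  antipode_left : ∀ a : A,
    TensorProduct.lift mul ((TensorProduct.map S LinearMap.id) (comul a)) = counit a • one
  antipode_right : ∀ a : A,
    TensorProduct.lift mul ((TensorProduct.map LinearMap.id S) (comul a)) = counit a • one

section Transport

variable {k : Type*} [Field k] {G : Type*} [Group G] {H : G → Type*}
  [∀ p, AddCommGroup (H p)] [∀ p, Module k (H p)]

/-- The comultiplication `H c → H a ⊗ H b` for `a * b = c`. -/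
def comulTo (T : HomTC k G H) {a b c : G} (h : a * b = c) : H c →ₗ[k] H a ⊗[k] H b :=
  (T.comul a b).comp (cst k h.symm)

/-- The crossing by `q` as a map `H a → H b` for `q * a * q⁻¹ = b`. -/
def crossTo (T : HomTC k G H) (q : G) {a b : G} (h : q * a * q⁻¹ = b) : H a →ₗ[k] H b :=
  (cst k h).comp (T.π q a).toLinearMap

lemma comulTo_coassoc (T : HomTC k G H) {a b c ab bc abc : G} (hab : a * b = ab)
    (hbc : b * c = bc) (h₁ : ab * c = abc) (h₂ : a * bc = abc) (x : H abc) :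
    TensorProduct.assoc k _ _ _
        (TensorProduct.map (comulTo T hab) (T.α c).symm.toLinearMap (comulTo T h₁ x))
      = TensorProduct.map (T.α a).symm.toLinearMap (comulTo T hbc) (comulTo T h₂ x) := by
  subst hab hbc h₁
  exact (LinearMap.congr_fun (T.ax.hcoassoc a b c) x).symm

lemma crossTo_mul (T : HomTC k G H) (q : G) {a b : G} (h : q * a * q⁻¹ = b) (x y : H a) :
    crossTo T q h (T.mul a x y) = T.mul b (crossTo T q h x) (crossTo T q h y) := by
  subst h
  exact T.cax.π_mul q a x y

lemma crossTo_α (T : HomTC k G H) (q : G) {a b : G} (h : q * a * q⁻¹ = b) (x : H a) :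
    crossTo T q h (T.α a x) = T.α b (crossTo T q h x) := by
  subst h
  exact T.cax.π_α q a x

lemma crossTo_crossTo (T : HomTC k G H) {q s t a b c : G} (hb : s * a * s⁻¹ = b)
    (hc : q * b * q⁻¹ = c) (ht : q * s = t) (h : t * a * t⁻¹ = c) (x : H a) :
    crossTo T q hc (crossTo T s hb x) = crossTo T t h x := by
  subst hb hc ht
  exact (T.cax.π_mult q s a x).symm

end Transport

section TensorYD

variable {k : Type*} [Field k] {G : Type*} [Group G] {H : G → Type*}
  [∀ p, AddCommGroup (H p)] [∀ p, Module k (H p)]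
  {M : Type*} [AddCommGroup M] [Module k M] {N : Type*} [AddCommGroup N] [Module k N]

/-- The bilinear map `b, x ↦ μ(x₍₀₎) ⊗ x₍₁₎ ⬝ φ(b)`. -/
def mulRight (T : HomTC k G H) {s r : G} (φ : H s →ₗ[k] H r) (μ : M →ₗ[k] M) :
    H s →ₗ[k] (M ⊗[k] H r) →ₗ[k] (M ⊗[k] H r) :=
  (TensorProduct.mapBilinear (RingHom.id k) M (H r) M (H r) μ).comp ((T.mul r).flip.comp φ)

@[simp]
lemma mulRight_tmul (T : HomTC k G H) {s r : G} (φ : H s →ₗ[k] H r) (μ : M →ₗ[k] M)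
    (b : H s) (m : M) (c : H r) :
    mulRight T φ μ b (m ⊗ₜ c) = μ m ⊗ₜ T.mul r c (φ b) := rfl

/-- The bilinear map `b, c ↦ μ((c ⬝ μ⁻¹ m)₍₀₎) ⊗ (c ⬝ μ⁻¹ m)₍₁₎ ⬝ φ(b)`. -/
def twistedCoact (T : HomTC k G H) {s r p : G} (φ : H s →ₗ[k] H r) (μ : M ≃ₗ[k] M)
    (act : H p →ₗ[k] M →ₗ[k] M) (ρ : M →ₗ[k] M ⊗[k] H r) (m : M) :
    H s →ₗ[k] H p →ₗ[k] M ⊗[k] H r :=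
  (mulRight T φ μ.toLinearMap).compl₂ (ρ.comp (act.flip (μ.symm m)))

@[simp]
lemma twistedCoact_apply (T : HomTC k G H) {s r p : G} (φ : H s →ₗ[k] H r) (μ : M ≃ₗ[k] M)
    (act : H p →ₗ[k] M →ₗ[k] M) (ρ : M →ₗ[k] M ⊗[k] H r) (m : M) (b : H s) (c : H p) :
    twistedCoact T φ μ act ρ m b c
      = mulRight T φ μ.toLinearMap b (ρ (act c (μ.symm m))) := rfl

lemma ydCompat_iff (T : HomTC k G H) (p : G) (μ : M ≃ₗ[k] M) (act : H p →ₗ[k] M →ₗ[k] M)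
    (ρ : ∀ r : G, M →ₗ[k] M ⊗[k] H r) :
    YDcompat k T p μ act ρ ↔ ∀ (r : G) (x : H (p * r)) (m : M),
      TensorProduct.map₂ act (T.mul r) (T.comul p r x) (ρ r m)
        = TensorProduct.lift (twistedCoact T
            (crossTo T p⁻¹ (show p⁻¹ * (p * r * p⁻¹) * p⁻¹⁻¹ = r by group)) μ act (ρ r) m)
          (comulTo T (show (p * r * p⁻¹) * p = p * r by group) x) := by
  refine forall_congr' fun r => ?_
  rw [TensorProduct.ext_iff, LinearMap.ext_iff]
  refine forall_congr' fun x => ?_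
  rw [LinearMap.ext_iff]
  refine forall_congr' fun m => ?_
  refine Eq.congr ?_ ?_
  · simp only [LinearMap.compr₂ₛₗ_apply, TensorProduct.mk_apply, LinearMap.comp_apply,
      TensorProduct.map_tmul, LinearEquiv.coe_coe]
    generalize T.comul p r x = z
    generalize ρ r m = y
    induction z with
    | zero => simp
    | add z₁ z₂ h₁ h₂ => simp only [TensorProduct.add_tmul, map_add, LinearMap.add_apply, h₁, h₂]
    | tmul a b =>
      induction y with
      | zero => simp
      | add y₁ y₂ h₁ h₂ => simp only [TensorProduct.tmul_add, map_add, h₁, h₂]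
      | tmul y c => simp
  · simp only [LinearMap.compr₂ₛₗ_apply, TensorProduct.mk_apply, LinearMap.comp_apply,
      TensorProduct.map_tmul, LinearEquiv.coe_coe, comulTo]
    generalize T.comul (p * r * p⁻¹) p _ = z
    induction z with
    | zero => simp
    | add z₁ z₂ h₁ h₂ => simp only [TensorProduct.add_tmul, map_add, h₁, h₂]
    | tmul a b =>
      simp only [TensorProduct.assoc_tmul, TensorProduct.map_tmul, TensorProduct.lift.tmul,
        LinearMap.comp_apply, twistedCoact_apply, TensorProduct.comm_tmul, LinearEquiv.coe_coe]
      generalize ρ r _ = y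
      induction y with
      | zero => simp
      | add y₁ y₂ h₁ h₂ => simp only [TensorProduct.add_tmul, map_add, h₁, h₂]
      | tmul y c => simp [crossTo]

lemma IsYD.map₂_comulTo {T : HomTC k G H} {p : G} {μ : M ≃ₗ[k] M} {act : H p →ₗ[k] M →ₗ[k] M}
    {ρ : ∀ r : G, M →ₗ[k] M ⊗[k] H r} (hM : IsYD k T p μ act ρ) {r s c : G} (h₁ : p * r = c)
    (h₂ : s * p = c) (h₃ : p⁻¹ * s * p⁻¹⁻¹ = r) (x : H c) (m : M) :
    TensorProduct.map₂ act (T.mul r) (comulTo T h₁ x) (ρ r m)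
      = TensorProduct.lift (twistedCoact T (crossTo T p⁻¹ h₃) μ act (ρ r) m)
          (comulTo T h₂ x) := by
  subst h₁
  obtain rfl : s = p * r * p⁻¹ := eq_mul_inv_of_mul_eq h₂
  exact (ydCompat_iff T p μ act ρ).1 hM.compat r x m

/-- The bilinear map `m ⊗ a, n ⊗ b ↦ (m ⊗ n) ⊗ b ⬝ φ(a)` entering the coaction on `M ⊗ N`. -/
def pairMul (T : HomTC k G H) {s r : G} (φ : H s →ₗ[k] H r)
    (M : Type*) [AddCommGroup M] [Module k M] (N : Type*) [AddCommGroup N] [Module k N] :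
    (M ⊗[k] H s) →ₗ[k] (N ⊗[k] H r) →ₗ[k] (M ⊗[k] N) ⊗[k] H r :=
  TensorProduct.curry ((TensorProduct.map LinearMap.id
      (TensorProduct.lift ((T.mul r).flip.comp φ))).comp
    (TensorProduct.tensorTensorTensorComm k M (H s) N (H r)).toLinearMap)

@[simp]
lemma pairMul_tmul (T : HomTC k G H) {s r : G} (φ : H s →ₗ[k] H r) (m : M) (a : H s) (n : N)
    (b : H r) : pairMul T φ M N (m ⊗ₜ a) (n ⊗ₜ b) = (m ⊗ₜ n) ⊗ₜ T.mul r b (φ a) := rfl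

lemma tCoact_tmul (T : HomTC k G H) (q : G) (ρM : ∀ r : G, M →ₗ[k] M ⊗[k] H r)
    (ρN : ∀ r : G, N →ₗ[k] N ⊗[k] H r) (r : G) (m : M) (n : N) :
    tCoact k T q ρM ρN r (m ⊗ₜ n)
      = pairMul T (crossTo T q⁻¹ (show q⁻¹ * (q * r * q⁻¹) * q⁻¹⁻¹ = r by group)) M N
          (ρM (q * r * q⁻¹) m) (ρN r n) := rfl

/-- The linear map `a ↦ a ⬝ m ⊗ f(c)` attached to a tensor `x = m ⊗ c`. -/
def actMap {X C : Type*} [AddCommGroup X] [Module k X] [AddCommGroup C] [Module k C]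
    (act : X →ₗ[k] M →ₗ[k] M) (f : C →ₗ[k] C) (x : M ⊗[k] C) : X →ₗ[k] M ⊗[k] C :=
  (((TensorProduct.mapBilinear (RingHom.id k) M C M C).flip f).comp act).flip x

@[simp]
lemma actMap_apply {X C : Type*} [AddCommGroup X] [Module k X] [AddCommGroup C] [Module k C]
    (act : X →ₗ[k] M →ₗ[k] M) (f : C →ₗ[k] C) (x : M ⊗[k] C) (a : X) :
    actMap act f x a = TensorProduct.map (act a) f x := rfl

/-- Bilinear maps out of tensor products agree when they agree on pure tensors. -/
lemma bilin_ext {A B C D V : Type*} [AddCommGroup A] [Module k A] [AddCommGroup B] [Module k B]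
    [AddCommGroup C] [Module k C] [AddCommGroup D] [Module k D] [AddCommGroup V] [Module k V]
    {f g : A ⊗[k] B →ₗ[k] C ⊗[k] D →ₗ[k] V}
    (h : ∀ a b c d, f (a ⊗ₜ b) (c ⊗ₜ d) = g (a ⊗ₜ b) (c ⊗ₜ d)) (x : A ⊗[k] B) (y : C ⊗[k] D) :
    f x y = g x y := by
  have : f = g := by
    ext a b c d
    exact h a b c d
  rw [this]

section Pair

variable (T : HomTC k G H) {s r : G} (π : H s →ₗ[k] H r)

lemma map_pairMul (hπα : ∀ a, π (T.α s a) = T.α r (π a)) (f : M →ₗ[k] M) (g : N →ₗ[k] N)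
    (c : H r) (x : M ⊗[k] H s) (y : N ⊗[k] H r) :
    TensorProduct.map (TensorProduct.map f g) (T.mul r c) (pairMul T π M N x y)
      = pairMul T π M N (TensorProduct.map f (T.α s).toLinearMap x)
          (TensorProduct.map g (T.mul r ((T.α r).symm c)) y) := by
  refine bilin_ext
    (f := (pairMul T π M N).compr₂ (TensorProduct.map (TensorProduct.map f g) (T.mul r c)))
    (g := (pairMul T π M N).compl₁₂ (TensorProduct.map f (T.α s).toLinearMap)
      (TensorProduct.map g (T.mul r ((T.α r).symm c)))) (fun m a n b => ?_) x y
  have := T.ax.hom_assoc r ((T.α r).symm c) b (π a)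
  simp only [LinearEquiv.apply_symm_apply] at this
  simp [this, hπα]

lemma pairMul_mulRight (hπα : ∀ a, π (T.α s a) = T.α r (π a))
    (hπ : ∀ a b, π (T.mul s a b) = T.mul r (π a) (π b)) (f : M →ₗ[k] M) (g : N →ₗ[k] N)
    (b : H s) (x : M ⊗[k] H s) (y : N ⊗[k] H r) :
    pairMul T π M N (TensorProduct.map f (T.α s).toLinearMap x) (mulRight T π g b y)
      = pairMul T π M N (TensorProduct.map f (T.mul s b) x)
          (TensorProduct.map g (T.α r).toLinearMap y) := by
  refine bilin_ext
    (f := (pairMul T π M N).compl₁₂ (TensorProduct.map f (T.α s).toLinearMap)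
      (mulRight T π g b))
    (g := (pairMul T π M N).compl₁₂ (TensorProduct.map f (T.mul s b))
      (TensorProduct.map g (T.α r).toLinearMap)) (fun m a n c => ?_) x y
  simp [hπα, hπ, T.ax.hom_assoc]

lemma pairMul_mulRight_left (hπα : ∀ a, π (T.α s a) = T.α r (π a))
    (hπ : ∀ a b, π (T.mul s a b) = T.mul r (π a) (π b)) {t : G} (φ : H t →ₗ[k] H s)
    (hφα : ∀ a, φ (T.α t a) = T.α s (φ a)) (f : M →ₗ[k] M)
    (g : N →ₗ[k] N) (b : H t) (x : M ⊗[k] H s) (y : N ⊗[k] H r) :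
    pairMul T π M N (mulRight T φ f ((T.α t).symm b) x)
        (TensorProduct.map g (T.α r).toLinearMap y)
      = mulRight T (π.comp φ) (TensorProduct.map f g) b (pairMul T π M N x y) := by
  refine bilin_ext
    (f := (pairMul T π M N).compl₁₂ (mulRight T φ f ((T.α t).symm b))
      (TensorProduct.map g (T.α r).toLinearMap))
    (g := (pairMul T π M N).compr₂ (mulRight T (π.comp φ) (TensorProduct.map f g) b))
    (fun m a n c => ?_) x y
  simp [hπ, T.ax.hom_assoc, ← hπα, ← hφα]

end Pair

lemma lift_twistedCoact_add (T : HomTC k G H) {s r p : G} (φ : H s →ₗ[k] H r) (μ : M ≃ₗ[k] M)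
    (act : H p →ₗ[k] M →ₗ[k] M) (ρ : M →ₗ[k] M ⊗[k] H r) (m₁ m₂ : M) (z : H s ⊗[k] H p) :
    TensorProduct.lift (twistedCoact T φ μ act ρ (m₁ + m₂)) z
      = TensorProduct.lift (twistedCoact T φ μ act ρ m₁) z
        + TensorProduct.lift (twistedCoact T φ μ act ρ m₂) z := by
  rw [← LinearMap.add_apply]
  congr 1
  ext b c
  simp

lemma map₂_tAct_pairMul (T : HomTC k G H) {p q s r : G} (π : H s →ₗ[k] H r)
    (hπα : ∀ a, π (T.α s a) = T.α r (π a))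
    (actM : H p →ₗ[k] M →ₗ[k] M) (actN : H q →ₗ[k] N →ₗ[k] N)
    (x : M ⊗[k] H s) (y : N ⊗[k] H r) (z : H (p * q) ⊗[k] H r) :
    TensorProduct.map₂ (tAct k T p q actM actN) (T.mul r) z (pairMul T π M N x y)
      = TensorProduct.lift ((pairMul T π M N).compl₁₂ (actMap actM (T.α s).toLinearMap x)
          ((TensorProduct.map₂ actN (T.mul r)).flip y))
        (TensorProduct.assoc k _ _ _
          (TensorProduct.map (T.comul p q) (T.α r).symm.toLinearMap z)) := by
  induction z with
  | zero => simp
  | add z₁ z₂ h₁ h₂ => simp only [map_add, LinearMap.add_apply, h₁, h₂]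
  | tmul a c =>
    simp only [TensorProduct.map₂_apply_tmul, tAct, LinearMap.comp_apply, TensorProduct.map_tmul]
    generalize T.comul p q a = t
    induction t with
    | zero => simp
    | add t₁ t₂ h₁ h₂ =>
      simp only [map_add, TensorProduct.map_add_left, LinearMap.add_apply, TensorProduct.add_tmul,
        h₁, h₂]
    | tmul a b => simp [map_pairMul T π hπα]

lemma IsYD.lift_pairMul_comulTo {T : HomTC k G H} {q : G} {ν : N ≃ₗ[k] N}
    {actN : H q →ₗ[k] N →ₗ[k] N} {ρN : ∀ r : G, N →ₗ[k] N ⊗[k] H r}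
    (hN : IsYD k T q ν actN ρN) {p r s c : G} (h₁ : q * r = c) (h₂ : s * q = c)
    (h₃ : q⁻¹ * s * q⁻¹⁻¹ = r) (actM : H p →ₗ[k] M →ₗ[k] M) (x : M ⊗[k] H s) (n : N)
    (z : H p ⊗[k] H c) :
    TensorProduct.lift ((pairMul T (crossTo T q⁻¹ h₃) M N).compl₁₂
          (actMap actM (T.α s).toLinearMap x)
          ((TensorProduct.map₂ actN (T.mul r)).flip (ρN r n)))
        (TensorProduct.map (T.α p).symm.toLinearMap (comulTo T h₁) z)
      = TensorProduct.lift ((pairMul T (crossTo T q⁻¹ h₃) M N).compl₁₂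
          ((TensorProduct.map₂ actM (T.mul s)).flip x)
          ((TensorProduct.map ν.toLinearMap (T.α r).toLinearMap).comp
            ((ρN r).comp (actN.flip (ν.symm n)))))
        ((TensorProduct.assoc k _ _ _).symm
          (TensorProduct.map (T.α p).symm.toLinearMap (comulTo T h₂) z)) := by
  induction z with
  | zero => simp
  | add z₁ z₂ h₁ h₂ => simp only [map_add, h₁, h₂]
  | tmul a c =>
    simp only [TensorProduct.map_tmul, TensorProduct.lift.tmul, LinearMap.compl₁₂_apply,
      LinearMap.flip_apply, actMap_apply, hN.map₂_comulTo h₁ h₂ h₃]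
    generalize comulTo T h₂ c = t
    induction t with
    | zero => simp
    | add t₁ t₂ h₁ h₂ => simp only [map_add, TensorProduct.tmul_add, h₁, h₂]
    | tmul b d =>
      simp [pairMul_mulRight T _ (crossTo_α T q⁻¹ h₃) (crossTo_mul T q⁻¹ h₃)]

lemma IsYD.lift_pairMul_comulTo_left {T : HomTC k G H} {p : G} {μ : M ≃ₗ[k] M}
    {actM : H p →ₗ[k] M →ₗ[k] M} {ρM : ∀ r : G, M →ₗ[k] M ⊗[k] H r}
    (hM : IsYD k T p μ actM ρM) {q r s t c : G} (h₁ : p * s = c) (h₂ : t * p = c)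
    (h₃ : p⁻¹ * t * p⁻¹⁻¹ = s) (π : H s →ₗ[k] H r) (hπα : ∀ a, π (T.α s a) = T.α r (π a))
    (hπ : ∀ a b, π (T.mul s a b) = T.mul r (π a) (π b)) (m : M) (ν : N →ₗ[k] N)
    (f : H q →ₗ[k] N ⊗[k] H r) (z : H c ⊗[k] H q) :
    TensorProduct.lift ((pairMul T π M N).compl₁₂
          ((TensorProduct.map₂ actM (T.mul s)).flip (ρM s m))
          ((TensorProduct.map ν (T.α r).toLinearMap).comp f))
        (TensorProduct.map (comulTo T h₁) (T.α q).symm.toLinearMap z)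
      = TensorProduct.lift ((mulRight T (π.comp (crossTo T p⁻¹ h₃))
            (TensorProduct.map μ.toLinearMap ν)).compl₁₂ (T.α t).toLinearMap
          (TensorProduct.lift ((pairMul T π M N).compl₁₂
            ((ρM s).comp (actM.flip (μ.symm m))) f)))
        (TensorProduct.assoc k _ _ _
          (TensorProduct.map (comulTo T h₂) (T.α q).symm.toLinearMap z)) := by
  induction z with
  | zero => simp
  | add z₁ z₂ h₁ h₂ => simp only [map_add, h₁, h₂]
  | tmul a d =>
    simp only [TensorProduct.map_tmul, TensorProduct.lift.tmul, LinearMap.compl₁₂_apply,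
      LinearMap.flip_apply, hM.map₂_comulTo h₁ h₂ h₃]
    generalize comulTo T h₂ a = t
    induction t with
    | zero => simp
    | add t₁ t₂ h₁ h₂ =>
      simp only [map_add, LinearMap.add_apply, TensorProduct.add_tmul, h₁, h₂]
    | tmul b c =>
      simp [← pairMul_mulRight_left T π hπα hπ _ (crossTo_α T p⁻¹ h₃)]

lemma lift_twistedCoact_tmul (T : HomTC k G H) {p q r t : G}
    (φ : H t →ₗ[k] H r) (μ : M ≃ₗ[k] M) (actM : H p →ₗ[k] M →ₗ[k] M)
    (ρM : ∀ r : G, M →ₗ[k] M ⊗[k] H r) (ν : N ≃ₗ[k] N) (actN : H q →ₗ[k] N →ₗ[k] N)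
    (ρN : ∀ r : G, N →ₗ[k] N ⊗[k] H r) (m : M) (n : N) (z : H t ⊗[k] H (p * q)) :
    TensorProduct.lift (twistedCoact T φ (TensorProduct.congr μ ν) (tAct k T p q actM actN)
        (tCoact k T q ρM ρN r) (m ⊗ₜ n)) z
      = TensorProduct.lift ((mulRight T φ
            (TensorProduct.map μ.toLinearMap ν.toLinearMap)).compl₁₂ (T.α t).toLinearMap
          (TensorProduct.lift ((pairMul T (crossTo T q⁻¹
              (show q⁻¹ * (q * r * q⁻¹) * q⁻¹⁻¹ = r by group)) M N).compl₁₂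
            ((ρM (q * r * q⁻¹)).comp (actM.flip (μ.symm m)))
            ((ρN r).comp (actN.flip (ν.symm n))))))
        (TensorProduct.map (T.α t).symm.toLinearMap (T.comul p q) z) := by
  induction z with
  | zero => simp
  | add z₁ z₂ h₁ h₂ => simp only [map_add, h₁, h₂]
  | tmul b c =>
    simp only [TensorProduct.map_tmul, TensorProduct.lift.tmul, LinearMap.compl₁₂_apply,
      twistedCoact_apply, tAct, LinearMap.comp_apply, LinearEquiv.coe_coe,
      LinearEquiv.apply_symm_apply, TensorProduct.congr_symm_tmul]
    generalize T.comul p q c = t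
    induction t with
    | zero => simp
    | add t₁ t₂ h₁ h₂ => simp only [map_add, LinearMap.add_apply, h₁, h₂]
    | tmul a d =>
      simp only [TensorProduct.map₂_apply_tmul, TensorProduct.map_tmul, tCoact_tmul]
      rfl

end TensorYD

/-- The Yetter-Drinfeld compatibility condition holds for the tensor
product of Yetter-Drinfeld modules. -/
theorem statement8 {k : Type*} [Field k] {G : Type*} [Group G] {H : G → Type*}
    [∀ p, AddCommGroup (H p)] [∀ p, Module k (H p)]
    (T : HomTC k G H) (p q : G)
    (M : Type*) [AddCommGroup M] [Module k M] (N : Type*) [AddCommGroup N] [Module k N]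
    (μ : M ≃ₗ[k] M) (actM : H p →ₗ[k] M →ₗ[k] M) (ρM : ∀ r : G, M →ₗ[k] M ⊗[k] H r)
    (ν : N ≃ₗ[k] N) (actN : H q →ₗ[k] N →ₗ[k] N) (ρN : ∀ r : G, N →ₗ[k] N ⊗[k] H r)
    (hM : IsYD k T p μ actM ρM) (hN : IsYD k T q ν actN ρN) :
    YDcompat k T (p * q) (TensorProduct.congr μ ν)
      (tAct k T p q actM actN) (tCoact k T q ρM ρN) := by
  rw [ydCompat_iff]
  intro r x w
  induction w with
  | zero =>
    have h := lift_twistedCoact_add T (crossTo T (p * q)⁻¹ (show (p * q)⁻¹ *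
      (p * q * r * (p * q)⁻¹) * (p * q)⁻¹⁻¹ = r by group)) (TensorProduct.congr μ ν)
      (tAct k T p q actM actN) (tCoact k T q ρM ρN r) 0 0
      (comulTo T (show (p * q * r * (p * q)⁻¹) * (p * q) = p * q * r by group) x)
    rw [add_zero, left_eq_add] at h
    rw [h, map_zero, map_zero]
  | add w₁ w₂ h₁ h₂ => rw [map_add, map_add, h₁, h₂, lift_twistedCoact_add]
  | tmul m n =>
    have e₁ : q * r * q⁻¹ * q = q * r := by group
    have e₂ : p * (q * r) = p * q * r := by group
    have e₃ : p * (q * r * q⁻¹) * q = p * q * r := by group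
    have e₄ : p * q * r * (p * q)⁻¹ * p = p * (q * r * q⁻¹) := by group
    have e₅ : p * q * r * (p * q)⁻¹ * (p * q) = p * q * r := by group
    have e₆ : p⁻¹ * (p * q * r * (p * q)⁻¹) * p⁻¹⁻¹ = q * r * q⁻¹ := by group
    have e₇ : q⁻¹ * (q * r * q⁻¹) * q⁻¹⁻¹ = r := by group
    have e₈ : (p * q)⁻¹ * (p * q * r * (p * q)⁻¹) * (p * q)⁻¹⁻¹ = r := by group
    have hφ : (crossTo T q⁻¹ e₇).comp (crossTo T p⁻¹ e₆) = crossTo T (p * q)⁻¹ e₈ :=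
      LinearMap.ext fun a => crossTo_crossTo T e₆ e₇ (mul_inv_rev p q).symm e₈ a
    have c₁ := comulTo_coassoc T (rfl : p * q = p * q) (rfl : q * r = q * r) rfl e₂ x
    have c₂ := comulTo_coassoc T (rfl : p * (q * r * q⁻¹) = _) e₁ e₃ e₂ x
    have c₃ := comulTo_coassoc T e₄ (rfl : p * q = p * q) e₃ e₅ x
    rw [tCoact_tmul, map₂_tAct_pairMul T _ (crossTo_α T q⁻¹ e₇)]
    refine (congrArg _ c₁).trans ?_
    rw [hN.lift_pairMul_comulTo rfl e₁ e₇, ← c₂, LinearEquiv.symm_apply_apply,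
      hM.lift_pairMul_comulTo_left rfl e₄ e₆ _ (crossTo_α T q⁻¹ e₇) (crossTo_mul T q⁻¹ e₇), c₃,
      hφ, lift_twistedCoact_tmul]
    rfl
end
end

section
/- Let (H, α) be a monoidal Hom-Hopf T-coalgebra over G with bijective antipode, (M, μ) a p-Yetter–Drinfeld module over (H, α), and s, t ∈ G. Then the st-conjugate module structure and the iterated conjugate structure on M coincide: ^{st}M = ^s(^tM) as stp t^{-1}s^{-1}-Yetter–Drinfeld modules, i.e. for all h ∈ H_{stp(st)^{-1}} the action h ⇀_{^{st}M} m = ^{st}(π_{(st)^{-1}}(h)·m) equals the action obtained by first t-conjugating and then s-conjugating, and for all r ∈ G the coaction ρ^{^{st}M}_r(m) = m_{(0)} ⊗ π_{st}(m_{(1,(st)^{-1}r(st))}) equals the coaction of ^s(^tM). -/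
open TensorProduct

noncomputable section

section Transport

variable {k : Type*} [Field k] {G : Type*} {H : G → Type*}
  [∀ p, AddCommGroup (H p)] [∀ p, Module k (H p)]

theorem coaction_eq_map_cst {M : Type*} [AddCommGroup M] [Module k M]
    (ρ : ∀ r : G, M →ₗ[k] M ⊗[k] H r) {a b : G} (h : a = b) :
    ρ b = (TensorProduct.map LinearMap.id (cst k h)).comp (ρ a) := by
  subst h
  change ρ a = (TensorProduct.map LinearMap.id LinearMap.id).comp (ρ a)
  rw [TensorProduct.map_id, LinearMap.id_comp]

/-- Multiplicativity of the crossing, up to transport on both sides. -/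
theorem HomTC.crossing_mul [Group G] (T : HomTC k G H) {a b c p p' q r : G} (hc : c = a * b)
    (hp : p = p') (h₁ : c * p * c⁻¹ = r) (h₂ : b * p' * b⁻¹ = q) (h₃ : a * q * a⁻¹ = r)
    (x : H p) :
    cst k h₁ (T.π c p x) = cst k h₃ (T.π a q (cst k h₂ (T.π b p' (cst k hp x)))) := by
  subst hc hp h₂ h₃
  exact T.cax.π_mult a b p x

end Transport

/-- `^{st}M = ^s(^tM)` as Yetter-Drinfeld modules. -/
theorem statement10 {k : Type*} [Field k] {G : Type*} [Group G] {H : G → Type*}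
    [∀ p, AddCommGroup (H p)] [∀ p, Module k (H p)]
    (T : HomTC k G H) (p s t : G)
    (M : Type*) [AddCommGroup M] [Module k M]
    (μ : M ≃ₗ[k] M) (actM : H p →ₗ[k] M →ₗ[k] M) (ρM : ∀ r : G, M →ₗ[k] M ⊗[k] H r)
    (hM : IsYD k T p μ actM ρM) :
    (∀ (h : H ((s * t) * p * (s * t)⁻¹)) (m : M),
      cAct k T (s * t) p actM h m
        = cAct k T s (t * p * t⁻¹) (cAct k T t p actM)
            (cst k (show (s * t) * p * (s * t)⁻¹ = s * (t * p * t⁻¹) * s⁻¹ by group) h) m)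
    ∧
    (∀ r : G, cCoact k T (s * t) ρM r = cCoact k T s (cCoact k T t ρM) r) := by
  refine ⟨fun h m => ?_, fun r => ?_⟩
  · exact congrArg (fun x => actM x m)
      (T.crossing_mul (mul_inv_rev s t) (by group) (by group) (by group) (by group) h)
  · unfold cCoact
    rw [coaction_eq_map_cst ρM
      (show (s * t)⁻¹ * r * (s * t) = t⁻¹ * (s⁻¹ * r * s) * t by group)]
    simp only [← LinearMap.comp_assoc, ← TensorProduct.map_comp, LinearMap.id_comp]
    congr 2
    ext x
    exact T.crossing_mul rfl (by group) (by group) (by group) (by group) x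
end
end

section
/- Let (H, α) be a monoidal Hom-Hopf T-coalgebra over G with bijective antipode, (M, μ) a p-Yetter–Drinfeld module, (N, ν) a q-Yetter–Drinfeld module over (H, α), and s ∈ G. Then ^s(M ⊗ N) = ^sM ⊗ ^sN as spqs^{-1}-Yetter–Drinfeld modules: the H_{spqs^{-1}}-action and the coactions ρ_r obtained by s-conjugating the tensor-product Yetter–Drinfeld structure on M ⊗ N coincide with the tensor-product Yetter–Drinfeld structure on ^sM ⊗ ^sN (where ^sM ∈ YD_{sps^{-1}} and ^sN ∈ YD_{sqs^{-1}}). -/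
open TensorProduct

noncomputable section

theorem coact_eq_map_cst {k : Type*} [Field k] {G : Type*} {H : G → Type*}
    [∀ p, AddCommGroup (H p)] [∀ p, Module k (H p)] {M : Type*} [AddCommGroup M] [Module k M]
    (ρ : ∀ r : G, M →ₗ[k] M ⊗[k] H r) {a b : G} (h : a = b) (m : M) :
    ρ b m = TensorProduct.map LinearMap.id (cst k h) (ρ a m) := by
  subst h
  exact (LinearMap.congr_fun TensorProduct.map_id (ρ a m)).symm

theorem map₂_comp_map {k : Type*} [Field k] {A A' B B' M N : Type*} [AddCommGroup A] [Module k A]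
    [AddCommGroup A'] [Module k A'] [AddCommGroup B] [Module k B] [AddCommGroup B'] [Module k B']
    [AddCommGroup M] [Module k M] [AddCommGroup N] [Module k N]
    (f : A →ₗ[k] M →ₗ[k] M) (g : B →ₗ[k] N →ₗ[k] N) (u : A' →ₗ[k] A) (v : B' →ₗ[k] B)
    (t : A' ⊗[k] B') :
    TensorProduct.map₂ (f.comp u) (g.comp v) t
      = TensorProduct.map₂ f g (TensorProduct.map u v t) := by
  induction t with
  | zero => simp
  | tmul a b => rfl
  | add a b ha hb => simp only [map_add, ha, hb]

section Conjugation

variable {k : Type*} [Field k] {G : Type*} [Group G] {H : G → Type*}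
  [∀ p, AddCommGroup (H p)] [∀ p, Module k (H p)]

/-- The crossing `π g : H a → H b`, where `b` is any element equal to `g * a * g⁻¹`. -/
def HomTC.conj (T : HomTC k G H) (g : G) {a b : G} (h : g * a * g⁻¹ = b) : H a →ₗ[k] H b :=
  (cst k h).comp (T.π g a).toLinearMap

namespace HomTC

variable (T : HomTC k G H)

theorem conj_conj {f g a b c u : G} (hb : f * a * f⁻¹ = b) (hc : g * b * g⁻¹ = c)
    (hu : g * f = u) (huc : u * a * u⁻¹ = c) (x : H a) :
    T.conj g hc (T.conj f hb x) = T.conj u huc x := by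
  subst hb hc hu
  exact (T.cax.π_mult g f a x).symm

theorem conj_cst {g a a' b : G} (h : a = a') (hb : g * a' * g⁻¹ = b)
    (hb' : g * a * g⁻¹ = b) (x : H a) :
    T.conj g hb (cst k h x) = T.conj g hb' x := by
  subst h
  rfl

theorem conj_mul {g a b : G} (h : g * a * g⁻¹ = b) (x y : H a) :
    T.conj g h (T.mul a x y) = T.mul b (T.conj g h x) (T.conj g h y) := by
  subst h
  exact T.cax.π_mul g a x y

theorem map_conj_comul {g a b a' b' : G} (ha : g * a * g⁻¹ = a') (hb : g * b * g⁻¹ = b')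
    (hab : g * (a * b) * g⁻¹ = a' * b') (x : H (a * b)) :
    TensorProduct.map (T.conj g ha) (T.conj g hb) (T.comul a b x)
      = T.comul a' b' (T.conj g hab x) := by
  subst ha hb
  exact T.cax.π_comul g a b x

end HomTC

theorem cAct_tAct (T : HomTC k G H) (p q s : G) {M N : Type*} [AddCommGroup M] [Module k M]
    [AddCommGroup N] [Module k N]
    (actM : H p →ₗ[k] M →ₗ[k] M) (actN : H q →ₗ[k] N →ₗ[k] N)
    (h : H (s * (p * q) * s⁻¹)) :
    cAct k T s (p * q) (tAct k T p q actM actN) h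
      = tAct k T (s * p * s⁻¹) (s * q * s⁻¹) (cAct k T s p actM) (cAct k T s q actN)
          (cst k (show s * (p * q) * s⁻¹ = (s * p * s⁻¹) * (s * q * s⁻¹) by group) h) := by
  refine Eq.trans ?_ (map₂_comp_map actM actN (T.conj s⁻¹ (by group)) (T.conj s⁻¹ (by group))
    _).symm
  rw [T.map_conj_comul _ _ (by group), T.conj_cst _ _ (by group)]
  rfl

theorem cCoact_tCoact (T : HomTC k G H) (q s r : G) {M N : Type*} [AddCommGroup M] [Module k M]
    [AddCommGroup N] [Module k N]
    (ρM : ∀ r : G, M →ₗ[k] M ⊗[k] H r) (ρN : ∀ r : G, N →ₗ[k] N ⊗[k] H r) :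
    cCoact k T s (tCoact k T q ρM ρN) r
      = tCoact k T (s * q * s⁻¹) (cCoact k T s ρM) (cCoact k T s ρN) r := by
  have ha : q * (s⁻¹ * r * s) * q⁻¹ = s⁻¹ * (s * q * s⁻¹ * r * (s * q * s⁻¹)⁻¹) * s := by group
  ext m n
  simp only [cCoact, tCoact, TensorProduct.AlgebraTensorModule.curry_apply,
    TensorProduct.curry_apply, LinearMap.coe_restrictScalars, LinearMap.comp_apply,
    TensorProduct.map_tmul, LinearEquiv.coe_coe]
  rw [coact_eq_map_cst ρM ha m]
  generalize ρM (q * (s⁻¹ * r * s) * q⁻¹) m = x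
  generalize ρN (s⁻¹ * r * s) n = y
  induction x with
  | zero => simp
  | add x x' hx hx' => simp only [map_add, TensorProduct.add_tmul, hx, hx']
  | tmul m a =>
    induction y with
    | zero => simp
    | add y y' hy hy' => simp only [map_add, TensorProduct.tmul_add, hy, hy']
    | tmul n b =>
      refine congrArg ((m ⊗ₜ[k] n) ⊗ₜ[k] ·) ?_
      refine (T.conj_mul (g := s) (by group) b (T.conj q⁻¹ (by group) a)).trans ?_
      refine congrArg (T.mul r (T.conj s (by group) b)) ?_
      refine Eq.trans ?_ (congrArg (T.conj (s * q * s⁻¹)⁻¹ (by group))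
        (T.conj_cst (g := s) ha (by group) (by group) a)).symm
      rw [T.conj_conj _ _ rfl (by group),
        T.conj_conj (u := s * q⁻¹) _ _ (by group) (by group)]

end Conjugation

/-- `^s(M ⊗ N) = ^sM ⊗ ^sN` as Yetter-Drinfeld modules. -/
theorem statement11 {k : Type*} [Field k] {G : Type*} [Group G] {H : G → Type*}
    [∀ p, AddCommGroup (H p)] [∀ p, Module k (H p)]
    (T : HomTC k G H) (p q s : G)
    (M : Type*) [AddCommGroup M] [Module k M] (N : Type*) [AddCommGroup N] [Module k N]
    (μ : M ≃ₗ[k] M) (actM : H p →ₗ[k] M →ₗ[k] M) (ρM : ∀ r : G, M →ₗ[k] M ⊗[k] H r)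
    (ν : N ≃ₗ[k] N) (actN : H q →ₗ[k] N →ₗ[k] N) (ρN : ∀ r : G, N →ₗ[k] N ⊗[k] H r)
    (hM : IsYD k T p μ actM ρM) (hN : IsYD k T q ν actN ρN) :
    (∀ (h : H (s * (p * q) * s⁻¹)) (x : M ⊗[k] N),
      cAct k T s (p * q) (tAct k T p q actM actN) h x
        = tAct k T (s * p * s⁻¹) (s * q * s⁻¹) (cAct k T s p actM) (cAct k T s q actN)
            (cst k (show s * (p * q) * s⁻¹ = (s * p * s⁻¹) * (s * q * s⁻¹) by group) h) x)
    ∧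
    (∀ r : G,
      cCoact k T s (tCoact k T q ρM ρN) r
        = tCoact k T (s * q * s⁻¹) (cCoact k T s ρM) (cCoact k T s ρN) r) := by
  exact ⟨fun h x => LinearMap.congr_fun (cAct_tAct T p q s actM actN h) x,
    fun r => cCoact_tCoact T q s r ρM ρN⟩
end
end

section
/- Let (H, α) be a monoidal Hom-Hopf T-coalgebra over G with bijective antipode, (M, μ) a p-Yetter–Drinfeld module and (N, ν) a q-Yetter–Drinfeld module over (H, α). Set ^MN = ^pN ∈ YD_{pqp^{-1}} and define c_{M,N}: M ⊗ N → ^MN ⊗ M by c_{M,N}(m ⊗ n) = ^p(S_{q^{-1}}(m_{(1,q^{-1})})·ν^{-1}(n)) ⊗ μ(m_{(0)}). Then c_{M,N} is H-linear: for all h ∈ H_{pq}, m ∈ M, n ∈ N, c_{M,N}(h·(m ⊗ n)) = h·c_{M,N}(m ⊗ n), where the left side uses the tensor H_{pq}-module structure of M ⊗ N ∈ YD_{pq} and the right side uses the tensor H_{(pqp^{-1})p} = H_{pq}-module structure of ^MN ⊗ M ∈ YD_{pq}. -/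
open TensorProduct

noncomputable section

section BraidInverse

variable {k : Type*} [Field k] {G : Type*} [Group G] {H : G → Type*}
  [∀ p, AddCommGroup (H p)] [∀ p, Module k (H p)]

lemma coact_cst {M : Type*} [AddCommGroup M] [Module k M] (ρ : ∀ r : G, M →ₗ[k] M ⊗[k] H r)
    {a b : G} (h : a = b) (m : M) :
    ρ b m = TensorProduct.map LinearMap.id (cst k h) (ρ a m) := by
  subst h
  simp [cst]

lemma IsYD.ρ_apply_μ {T : HomTC k G H} {p : G} {M : Type*} [AddCommGroup M] [Module k M]
    {μ : M ≃ₗ[k] M} {act : H p →ₗ[k] M →ₗ[k] M} {ρ : ∀ r : G, M →ₗ[k] M ⊗[k] H r}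
    (hM : IsYD k T p μ act ρ) (r : G) (m : M) :
    ρ r (μ m) = TensorProduct.map μ.toLinearMap (T.α r).toLinearMap (ρ r m) :=
  LinearMap.congr_fun (hM.ρ_μ r) m

lemma IsYD.μ_symm_act {T : HomTC k G H} {p : G} {M : Type*} [AddCommGroup M] [Module k M]
    {μ : M ≃ₗ[k] M} {act : H p →ₗ[k] M →ₗ[k] M} {ρ : ∀ r : G, M →ₗ[k] M ⊗[k] H r}
    (hM : IsYD k T p μ act ρ) (a : H p) (m : M) :
    μ.symm (act a m) = act ((T.α p).symm a) (μ.symm m) := by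
  rw [LinearEquiv.symm_apply_eq, hM.μ_act]
  simp

/-- The iterated action, with the structure automorphism moved to the acting elements. -/
lemma IsYD.act_act_symm {T : HomTC k G H} {p : G} {M : Type*} [AddCommGroup M] [Module k M]
    {μ : M ≃ₗ[k] M} {act : H p →ₗ[k] M →ₗ[k] M} {ρ : ∀ r : G, M →ₗ[k] M ⊗[k] H r}
    (hM : IsYD k T p μ act ρ) (a b : H p) (m : M) :
    act a (act b m) = act (T.mul p ((T.α p).symm a) b) (μ m) := by
  rw [← hM.act_act]
  simp

lemma HomTC.α_symm_mul (T : HomTC k G H) (p : G) (a b : H p) :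
    (T.α p).symm (T.mul p a b) = T.mul p ((T.α p).symm a) ((T.α p).symm b) := by
  rw [LinearEquiv.symm_apply_eq, T.ax.α_mul]
  simp

lemma α_cst (T : HomTC k G H) {a b : G} (h : a = b) (x : H a) :
    cst k h (T.α a x) = T.α b (cst k h x) := by
  subst h
  rfl

/-- The antipode `H p⁻¹ → H p`. -/
def antipodeInv (T : HomTC k G H) (p : G) : H p⁻¹ →ₗ[k] H p :=
  (cst k (inv_inv p)).comp (T.antipode p⁻¹).toLinearMap

lemma antipodeInv_α (T : HomTC k G H) (p : G) (a : H p⁻¹) :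
    antipodeInv T p (T.α p⁻¹ a) = T.α p (antipodeInv T p a) := by
  have h := T.ax.antipode_α p⁻¹ a
  simp only [LinearEquiv.coe_coe] at h
  simp [antipodeInv, h, α_cst]

lemma antipodeInv_α_symm (T : HomTC k G H) (p : G) (a : H p⁻¹) :
    antipodeInv T p ((T.α p⁻¹).symm a) = (T.α p).symm (antipodeInv T p a) := by
  rw [LinearEquiv.eq_symm_apply, ← antipodeInv_α]
  simp

variable {M N : Type*} [AddCommGroup M] [Module k M] [AddCommGroup N] [Module k N]

/-- The map `N ⊗ M → M ⊗ N`, `n ⊗ m ↦ μ m₍₀₎ ⊗ m₍₁,q₎ ⬝ ν⁻¹ n`, inverse to the braiding. -/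
def braidInv (q : G) (μ : M ≃ₗ[k] M) (ρM : ∀ r : G, M →ₗ[k] M ⊗[k] H r)
    (actN : H q →ₗ[k] N →ₗ[k] N) (ν : N ≃ₗ[k] N) : N ⊗[k] M →ₗ[k] M ⊗[k] N :=
  ((TensorProduct.map μ.toLinearMap (TensorProduct.lift actN)).comp
    ((TensorProduct.assoc k M (H q) N).toLinearMap.comp
      (TensorProduct.map (ρM q) ν.symm.toLinearMap))).comp
    (TensorProduct.comm k N M).toLinearMap

lemma braidInv_tmul (q : G) (μ : M ≃ₗ[k] M) (ρM : ∀ r : G, M →ₗ[k] M ⊗[k] H r)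
    (actN : H q →ₗ[k] N →ₗ[k] N) (ν : N ≃ₗ[k] N) (n : N) (m : M) :
    braidInv q μ ρM actN ν (n ⊗ₜ[k] m)
      = TensorProduct.map μ.toLinearMap (actN.flip (ν.symm n)) (ρM q m) := by
  simp only [braidInv, LinearMap.comp_apply, LinearEquiv.coe_coe, TensorProduct.comm_tmul,
    TensorProduct.map_tmul]
  induction ρM q m using TensorProduct.induction_on with
  | zero => simp
  | tmul x a => simp
  | add s t hs ht => simp only [TensorProduct.add_tmul, map_add, hs, ht]

lemma braid_tmul (T : HomTC k G H) (q : G) (μ : M ≃ₗ[k] M)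
    (ρM : ∀ r : G, M →ₗ[k] M ⊗[k] H r)
    (actN : H q →ₗ[k] N →ₗ[k] N) (ν : N ≃ₗ[k] N) (m : M) (n : N) :
    braid k T q μ ρM actN ν (m ⊗ₜ[k] n)
      = TensorProduct.comm k M N (TensorProduct.map μ.toLinearMap
          ((actN.flip (ν.symm n)).comp (antipodeInv T q)) (ρM q⁻¹ m)) := by
  simp only [braid, LinearMap.comp_apply, LinearEquiv.coe_coe, TensorProduct.map_tmul]
  induction ρM q⁻¹ m using TensorProduct.induction_on with
  | zero => simp
  | tmul x a => simp [antipodeInv]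
  | add s t hs ht => simp only [TensorProduct.add_tmul, map_add, hs, ht]

variable {T : HomTC k G H} {p q : G}
  {μ : M ≃ₗ[k] M} {actM : H p →ₗ[k] M →ₗ[k] M} {ρM : ∀ r : G, M →ₗ[k] M ⊗[k] H r}
  {ν : N ≃ₗ[k] N} {actN : H q →ₗ[k] N →ₗ[k] N} {ρN : ∀ r : G, N →ₗ[k] N ⊗[k] H r}

/-- Contracting an iterated coaction `m₍₀₎ ⊗ m₍₁,a₎ ⊗ m₍₂,b₎` along a map `f` which is
convolution-trivial recovers the counit. -/
lemma contract_coact (hM : IsYD k T p μ actM ρM) (hN : IsYD k T q ν actN ρN) {a b : G}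
    (hab : 1 = a * b) (f : H a ⊗[k] H b →ₗ[k] H q)
    (hf : ∀ x : H (1 : G), f (T.comul a b (cst k hab x)) = T.counit x • T.one q)
    (m : M) (n : N) :
    TensorProduct.map (μ.toLinearMap.comp μ.toLinearMap) ((actN.flip (ν.symm n)).comp f)
      (TensorProduct.assoc k M (H a) (H b)
        (TensorProduct.map (ρM a) (T.α b).symm.toLinearMap (ρM b m))) = m ⊗ₜ[k] n := by
  have h := LinearMap.congr_fun (hM.ρ_coassoc a b) m
  simp only [LinearMap.comp_apply, LinearEquiv.coe_coe] at h
  rw [← h, coact_cst ρM hab m]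
  have key : ∀ u : M ⊗[k] H (1 : G),
      TensorProduct.map (μ.toLinearMap.comp μ.toLinearMap) ((actN.flip (ν.symm n)).comp f)
        (TensorProduct.map μ.symm.toLinearMap (T.comul a b)
          (TensorProduct.map LinearMap.id (cst k hab) u))
      = μ (TensorProduct.rid k M (TensorProduct.map LinearMap.id T.counit u)) ⊗ₜ[k] n := by
    intro u
    induction u using TensorProduct.induction_on with
    | zero => simp
    | tmul x c => simp [hf, hN.act_one, TensorProduct.smul_tmul']
    | add s t hs ht => simp only [TensorProduct.add_tmul, map_add, hs, ht]
  rw [key, hM.ρ_counit]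
  simp

lemma braidInv_braid (hM : IsYD k T p μ actM ρM) (hN : IsYD k T q ν actN ρN)
    (x : M ⊗[k] N) :
    braidInv q μ ρM actN ν (braid k T q μ ρM actN ν x) = x := by
  induction x using TensorProduct.induction_on with
  | zero => simp
  | add s t hs ht => simp only [map_add, hs, ht]
  | tmul m n =>
    rw [braid_tmul]
    refine Eq.trans ?_ (contract_coact hM hN (a := q) (b := q⁻¹) (by group)
      ((TensorProduct.lift (T.mul q)).comp
        (TensorProduct.map LinearMap.id (antipodeInv T q)))
      (fun x => T.ax.antipode_right q x) m n)
    induction ρM q⁻¹ m using TensorProduct.induction_on with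
    | zero => simp
    | add s t hs ht => simp only [map_add, hs, ht]
    | tmul x a =>
      simp only [TensorProduct.map_tmul, TensorProduct.comm_tmul, braidInv_tmul,
        LinearEquiv.coe_coe, hM.ρ_apply_μ]
      induction ρM q x using TensorProduct.induction_on with
      | zero => simp
      | add s t hs ht => simp only [TensorProduct.add_tmul, map_add, hs, ht]
      | tmul y b =>
        simp [hN.μ_symm_act, hN.act_act_symm, antipodeInv_α_symm]

lemma braid_braidInv (hM : IsYD k T p μ actM ρM) (hN : IsYD k T q ν actN ρN)
    (x : N ⊗[k] M) :
    braid k T q μ ρM actN ν (braidInv q μ ρM actN ν x) = x := by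
  induction x using TensorProduct.induction_on with
  | zero => simp
  | add s t hs ht => simp only [map_add, hs, ht]
  | tmul n m =>
    rw [braidInv_tmul]
    have hc := congrArg (TensorProduct.comm k M N) (contract_coact hM hN (a := q⁻¹) (b := q)
      (by group) ((TensorProduct.lift (T.mul q)).comp
        (TensorProduct.map (antipodeInv T q) LinearMap.id))
      (fun x => T.ax.antipode_left q x) m n)
    rw [TensorProduct.comm_tmul] at hc
    refine Eq.trans ?_ hc
    clear hc
    induction ρM q m using TensorProduct.induction_on with
    | zero => simp
    | add s t hs ht => simp only [map_add, hs, ht]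
    | tmul x a =>
      simp only [TensorProduct.map_tmul, braid_tmul, LinearEquiv.coe_coe, hM.ρ_apply_μ]
      induction ρM q⁻¹ x using TensorProduct.induction_on with
      | zero => simp
      | add s t hs ht => simp only [TensorProduct.add_tmul, map_add, hs, ht]
      | tmul y b =>
        simp [hN.μ_symm_act, hN.act_act_symm, antipodeInv_α]

/-- The inverse of the braiding is `H`-linear; this is the Yetter-Drinfeld compatibility. -/
lemma braidInv_tAct (hM : IsYD k T p μ actM ρM) (hN : IsYD k T q ν actN ρN)
    (h : H (p * q)) (x : N ⊗[k] M) :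
    braidInv q μ ρM actN ν (tAct k T (p * q * p⁻¹) p (cAct k T p q actN) actM
        (cst k (show p * q = (p * q * p⁻¹) * p by group) h) x)
      = tAct k T p q actM actN h (braidInv q μ ρM actN ν x) := by
  induction x using TensorProduct.induction_on with
  | zero => simp
  | add s t hs ht => simp only [map_add, hs, ht]
  | tmul n m =>
    have hc := congrArg
      (TensorProduct.map LinearMap.id ((actN.flip n).comp (T.α q).symm.toLinearMap))
      (LinearMap.congr_fun (hM.compat q) (h ⊗ₜ[k] μ m))
    simp only [LinearMap.comp_apply, LinearEquiv.coe_coe, TensorProduct.map_tmul,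
      LinearEquiv.symm_apply_apply, hM.ρ_apply_μ] at hc
    simp only [tAct, LinearMap.comp_apply, braidInv_tmul]
    refine Eq.trans ?_ (hc.symm.trans ?_)
    · induction T.comul (p * q * p⁻¹) p
          (cst k (show p * q = (p * q * p⁻¹) * p by group) h) using TensorProduct.induction_on with
      | zero => simp
      | add s t hs ht => simp only [TensorProduct.add_tmul, map_add, LinearMap.add_apply, hs, ht]
      | tmul a b =>
        simp only [TensorProduct.map₂_apply_tmul, TensorProduct.map_tmul, braidInv_tmul,
          TensorProduct.assoc_tmul, LinearMap.comp_apply, LinearEquiv.coe_coe,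
          TensorProduct.comm_tmul, TensorProduct.lift.tmul, cAct]
        induction ρM q (actM b m) using TensorProduct.induction_on with
        | zero => simp
        | add s t hs ht => simp only [TensorProduct.add_tmul, map_add, hs, ht]
        | tmul y c => simp [hN.μ_symm_act, hN.act_act_symm, T.α_symm_mul]
    · induction T.comul p q h using TensorProduct.induction_on with
      | zero => simp
      | add s t hs ht => simp only [TensorProduct.add_tmul, map_add, LinearMap.add_apply, hs, ht]
      | tmul a b =>
        induction ρM q m using TensorProduct.induction_on with
        | zero => simp
        | add s t hs ht => simp only [TensorProduct.tmul_add, map_add, hs, ht]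
        | tmul y c => simp [hN.act_act_symm, T.α_symm_mul]

end BraidInverse

/-- The braiding `c_{M,N}` is `H`-linear. -/
theorem statement12 {k : Type*} [Field k] {G : Type*} [Group G] {H : G → Type*}
    [∀ p, AddCommGroup (H p)] [∀ p, Module k (H p)]
    (T : HomTC k G H) (p q : G)
    (M : Type*) [AddCommGroup M] [Module k M] (N : Type*) [AddCommGroup N] [Module k N]
    (μ : M ≃ₗ[k] M) (actM : H p →ₗ[k] M →ₗ[k] M) (ρM : ∀ r : G, M →ₗ[k] M ⊗[k] H r)
    (ν : N ≃ₗ[k] N) (actN : H q →ₗ[k] N →ₗ[k] N) (ρN : ∀ r : G, N →ₗ[k] N ⊗[k] H r)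
    (hM : IsYD k T p μ actM ρM) (hN : IsYD k T q ν actN ρN) :
    ∀ (h : H (p * q)) (m : M) (n : N),
      braid k T q μ ρM actN ν (tAct k T p q actM actN h (m ⊗ₜ[k] n))
        = tAct k T (p * q * p⁻¹) p (cAct k T p q actN) actM
            (cst k (show p * q = (p * q * p⁻¹) * p by group) h)
            (braid k T q μ ρM actN ν (m ⊗ₜ[k] n)) := by
  intro h m n
  rw [← braid_braidInv hM hN (tAct k T (p * q * p⁻¹) p (cAct k T p q actN) actM _ _),
    braidInv_tAct hM hN, braidInv_braid hM hN]
end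
end
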